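/- Derivation–division theorem. Let d, l ≥ 1, let λ₀ ∈ ℝ^d, and let J be a finite set. Suppose given: smooth (C^∞) functions a_i, b_i : ℝ^d → ℝ and c_{i,j} : ℝ^d → ℝ for 1 ≤ i ≤ l and j ∈ J; smooth functions γ_j : ℝ^d → ℝ with γ_j(λ₀) = 0 for all j ∈ J; continuous functions A_i : ℝ^d → ℝ; and functions g_i(r, ρ, λ) defined for (r, ρ) ∈ (0,1)² and λ ∈ ℝ^d such that for each fixed λ the map (r, ρ) ↦ g_i(r, ρ, λ) is of class C^l on (0,1)², and for every 0 ≤ m ≤ l the m-th iterated Lie derivative (L_X)^m g_i(r, ρ, λ) tends to 0 as (r, ρ, λ) → (0, 0, λ₀) with (r, ρ) ∈ (0,1)². Define the leading monomials M_i(r, ρ, λ) = r^{a_i(λ)} · ρ^{b_i(λ)} · ∏_{j∈J} ω(r, γ_j(λ))^{c_{i,j}(λ)} and V(r, ρ, λ) = ∑_{i=1}^{l} A_i(λ)·M_i(r, ρ, λ)·(1 + g_i(r, ρ, λ)). Assume the non-resonance condition: the l real numbers a_i(λ₀) − b_i(λ₀), 1 ≤ i ≤ l, are pairwise distinct. Then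 there exist ε ∈ (0,1) and a neighborhood ℬ of λ₀ in ℝ^d such that for every λ ∈ ℬ: either A_i(λ) = 0 for every i (in which case V(·, ·, λ) vanishes identically), or for every ν > 0 the function (r, ρ) ↦ V(r, ρ, λ) has at most l − 1 zeros on the curve {(r, ρ) : r·ρ = ν, 0 < r ≤ ε, 0 < ρ ≤ ε}. -/

import Mathlib

noncomputable def omega (ξ α : ℝ) : ℝ :=
  if α = 0 then -Real.log ξ else (ξ ^ (-α) - 1) / α

/-- The Lie derivative along the radial vector field `X = r ∂/∂r − ρ ∂/∂ρ`. -/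
noncomputable def LX (f : ℝ × ℝ → ℝ) (p : ℝ × ℝ) : ℝ :=
  p.1 * deriv (fun r => f (r, p.2)) p.1 - p.2 * deriv (fun ρ => f (p.1, ρ)) p.2

open Filter Topology Set

/-- `u` tends to `α` along `F`, and its first `n` derivatives in the real variable exist
eventually along `F` and tend to `0`. -/
def TendstoWithDerivs {P : Type*} (F : Filter (P × ℝ)) : ℕ → (P × ℝ → ℝ) → ℝ → Prop
  | 0, u, α => Tendsto u F (𝓝 α)
  | n + 1, u, α => Tendsto u F (𝓝 α) ∧ ∃ u' : P × ℝ → ℝ,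
      (∀ᶠ x in F, HasDerivAt (fun s => u (x.1, s)) (u' x) x.2) ∧ TendstoWithDerivs F n u' 0

namespace TendstoWithDerivs

variable {P : Type*} {F : Filter (P × ℝ)} {u v : P × ℝ → ℝ} {α β : ℝ} {n : ℕ}

theorem tendsto (h : TendstoWithDerivs F n u α) : Tendsto u F (𝓝 α) := by
  cases n with
  | zero => exact h
  | succ n => exact h.1

theorem of_succ (h : TendstoWithDerivs F (n + 1) u α) : TendstoWithDerivs F n u α := by
  induction n generalizing u α with
  | zero => exact h.1
  | succ n ih =>
    obtain ⟨h0, u', hu, h'⟩ := h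
    exact ⟨h0, u', hu, ih h'⟩

theorem comp_fst {c : P → ℝ} (h : Tendsto (fun x : P × ℝ => c x.1) F (𝓝 α)) :
    TendstoWithDerivs F n (fun x => c x.1) α := by
  induction n generalizing c α with
  | zero => exact h
  | succ n ih =>
    exact ⟨h, fun _ => 0, Eventually.of_forall fun x => hasDerivAt_const x.2 (c x.1),
      ih (c := fun _ => 0) tendsto_const_nhds⟩

theorem add (hu : TendstoWithDerivs F n u α) (hv : TendstoWithDerivs F n v β) :
    TendstoWithDerivs F n (fun x => u x + v x) (α + β) := by
  induction n generalizing u v α β with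
  | zero => exact Tendsto.add hu hv
  | succ n ih =>
    obtain ⟨hu0, u', hu1, hu2⟩ := hu
    obtain ⟨hv0, v', hv1, hv2⟩ := hv
    refine ⟨hu0.add hv0, fun x => u' x + v' x, ?_, by simpa using ih hu2 hv2⟩
    filter_upwards [hu1, hv1] with x h1 h2 using h1.add h2

theorem mul (hu : TendstoWithDerivs F n u α) (hv : TendstoWithDerivs F n v β) :
    TendstoWithDerivs F n (fun x => u x * v x) (α * β) := by
  induction n generalizing u v α β with
  | zero => exact Tendsto.mul hu hv
  | succ n ih =>
    have hu' := hu.of_succ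
    have hv' := hv.of_succ
    obtain ⟨hu0, u', hu1, hu2⟩ := hu
    obtain ⟨hv0, v', hv1, hv2⟩ := hv
    refine ⟨hu0.mul hv0, fun x => u' x * v x + u x * v' x, ?_,
      by simpa using (ih hu2 hv').add (ih hu' hv2)⟩
    filter_upwards [hu1, hv1] with x h1 h2 using h1.mul h2

theorem neg (hu : TendstoWithDerivs F n u α) : TendstoWithDerivs F n (fun x => -u x) (-α) := by
  simpa using (comp_fst (c := fun _ => -1) tendsto_const_nhds).mul hu

theorem sub (hu : TendstoWithDerivs F n u α) (hv : TendstoWithDerivs F n v β) :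
    TendstoWithDerivs F n (fun x => u x - v x) (α - β) := by
  simpa [sub_eq_add_neg] using hu.add hv.neg

theorem sum {ι : Type*} (s : Finset ι) {w : ι → P × ℝ → ℝ} {δ : ι → ℝ}
    (h : ∀ i ∈ s, TendstoWithDerivs F n (w i) (δ i)) :
    TendstoWithDerivs F n (fun x => ∑ i ∈ s, w i x) (∑ i ∈ s, δ i) := by
  classical
  induction s using Finset.induction_on with
  | empty => simpa using comp_fst (c := fun _ => 0) tendsto_const_nhds
  | insert i s hi ih =>
    simp only [Finset.sum_insert hi]
    exact (h i (Finset.mem_insert_self i s)).add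
      (ih fun j hj => h j (Finset.mem_insert_of_mem hj))

theorem inv (hu : TendstoWithDerivs F n u α) (hα : α ≠ 0) :
    TendstoWithDerivs F n (fun x => (u x)⁻¹) α⁻¹ := by
  induction n with
  | zero => exact Tendsto.inv₀ hu hα
  | succ n ih =>
    have hi := ih hu.of_succ
    obtain ⟨hu0, u', hu1, hu2⟩ := hu
    refine ⟨hu0.inv₀ hα, fun x => -u' x * ((u x)⁻¹ * (u x)⁻¹), ?_,
      by simpa using hu2.neg.mul (hi.mul hi)⟩
    filter_upwards [hu1, hu0.eventually_ne hα] with x h1 h2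
    exact (h1.fun_inv h2).congr_deriv (by simp only [Prod.mk.eta]; field_simp)

/-- A solution of the Bernoulli equation `u' = u ^ 2 + c u` tending to `0` does so together with
all its derivatives. -/
theorem of_bernoulli {c : P → ℝ} (hc : Tendsto (fun x : P × ℝ => c x.1) F (𝓝 0))
    (hu : Tendsto u F (𝓝 0))
    (hd : ∀ᶠ x in F, HasDerivAt (fun s => u (x.1, s)) (u x * u x + c x.1 * u x) x.2) :
    TendstoWithDerivs F n u 0 := by
  induction n with
  | zero => exact hu
  | succ n ih => exact ⟨hu, _, hd, by simpa using (ih.mul ih).add ((comp_fst hc).mul ih)⟩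

end TendstoWithDerivs

/-- **Rolle's theorem**, counting zeros. -/
theorem encard_zeros_le_encard_zeros_deriv_add_one {I : Set ℝ} (hI : I.OrdConnected)
    {f f' : ℝ → ℝ} (hf : ∀ t ∈ I, HasDerivAt f (f' t) t) :
    {t | t ∈ I ∧ f t = 0}.encard ≤ {t | t ∈ I ∧ f' t = 0}.encard + 1 := by
  by_cases hfin : {t | t ∈ I ∧ f' t = 0}.Finite
  swap
  · rw [Set.Infinite.encard_eq hfin]; simp
  rw [hfin.encard_eq_coe_toFinset_card]
  by_contra! hlt
  obtain ⟨s, hs, hcard⟩ := Set.exists_subset_encard_eq (Order.add_one_le_of_lt hlt)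
  have hsfin : s.Finite := Set.finite_of_encard_le_coe (k := hfin.toFinset.card + 1 + 1)
    (by rw [hcard]; push_cast; exact le_rfl)
  have hle : hsfin.toFinset.card ≤ hfin.toFinset.card + 1 := by
    apply Finset.card_le_of_interleaved
    intro x hx y hy hxy _
    obtain ⟨hxI, hx0⟩ := hs (hsfin.mem_toFinset.1 hx)
    obtain ⟨hyI, hy0⟩ := hs (hsfin.mem_toFinset.1 hy)
    have hsub := hI.out hxI hyI
    obtain ⟨z, hz, hz0⟩ := exists_hasDerivAt_eq_zero hxy
      (fun t ht => (hf t (hsub ht)).continuousAt.continuousWithinAt) (hx0.trans hy0.symm)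
      (fun t ht => hf t (hsub (Ioo_subset_Icc_self ht)))
    exact ⟨z, hfin.mem_toFinset.2 ⟨hsub (Ioo_subset_Icc_self hz), hz0⟩, hz.1, hz.2⟩
  rw [hsfin.encard_eq_coe_toFinset_card] at hcard
  have : hsfin.toFinset.card = hfin.toFinset.card + 1 + 1 := by exact_mod_cast hcard
  omega

/-- Functions whose logarithmic derivatives are close to distinct constants form a Chebyshev
system. -/
theorem exists_encard_zeros_sum_le {P : Type*} {F : Filter (P × ℝ)} {k : ℕ}
    {u : Fin (k + 1) → P × ℝ → ℝ} {α : Fin (k + 1) → ℝ} (hα : Function.Injective α)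
    (hu : ∀ i, TendstoWithDerivs F k (u i) (α i)) :
    ∃ S ∈ F, ∀ (p : P) (I : Set ℝ), I.OrdConnected → (∀ t ∈ I, (p, t) ∈ S) →
      ∀ (f : Fin (k + 1) → ℝ → ℝ) (A : Fin (k + 1) → ℝ),
        (∀ i, ∀ t ∈ I, f i t ≠ 0) →
        (∀ i, ∀ t ∈ I, HasDerivAt (f i) (f i t * u i (p, t)) t) →
        (∃ i, A i ≠ 0) → {t | t ∈ I ∧ ∑ i, A i * f i t = 0}.encard ≤ k := by
  induction k with
  | zero =>
    refine ⟨univ, univ_mem, fun p I _ _ f A hf _ hA => ?_⟩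
    obtain ⟨i, hi⟩ := hA
    rw [show i = 0 from Subsingleton.elim (α := Fin 1) i 0] at hi
    refine (encard_eq_zero.2 (eq_empty_iff_forall_notMem.2 ?_)).le
    rintro t ⟨ht, h⟩
    have hsum : ∑ i, A i * f i t = A 0 * f 0 t := Fin.sum_univ_one fun i => A i * f i t
    exact mul_ne_zero hi (hf 0 t ht) (hsum ▸ h)
  | succ k ih =>
    have hv (i : Fin (k + 1)) := (hu i.succ).sub (hu 0)
    have hv0 (i : Fin (k + 1)) : α i.succ - α 0 ≠ 0 :=
      sub_ne_zero.2 fun h => Fin.succ_ne_zero i (hα h)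
    choose v' hv' hv'0 using fun i => (hv i).2
    obtain ⟨S, hS, H⟩ := ih (u := fun i x => (u i.succ x - u 0 x) + v' i x * (u i.succ x - u 0 x)⁻¹)
      (α := fun i => α i.succ - α 0)
      (fun i j hij => Fin.succ_injective _ (hα (sub_left_injective hij)))
      (fun i => by simpa using (hv i).of_succ.add ((hv'0 i).mul ((hv i).of_succ.inv (hv0 i))))
    refine ⟨_, inter_mem hS (inter_mem (eventually_all.2 hv')
      (eventually_all.2 fun i => (hv i).tendsto.eventually_ne (hv0 i))), ?_⟩
    intro p I hI hIS f A hf hf' hA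
    have hquot : {t | t ∈ I ∧ ∑ i, A i * f i t = 0} =
        {t | t ∈ I ∧ A 0 + ∑ i : Fin (k + 1), A i.succ * (f i.succ t / f 0 t) = 0} := by
      ext t
      refine and_congr_right fun ht => ?_
      have h0 := hf 0 t ht
      rw [Fin.sum_univ_succ, ← mul_eq_zero_iff_right (a := A 0 + _) h0, add_mul, Finset.sum_mul]
      simp only [mul_assoc, div_mul_cancel₀ _ h0]
    rw [hquot]
    by_cases hA' : ∃ i : Fin (k + 1), A i.succ ≠ 0
    swap
    · push Not at hA'
      have hA0 : A 0 ≠ 0 := by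
        obtain ⟨i, hi⟩ := hA
        rcases Fin.eq_zero_or_eq_succ i with rfl | ⟨j, rfl⟩
        exacts [hi, absurd (hA' j) hi]
      simp [hA', hA0]
    have hq (i : Fin (k + 1)) (t : ℝ) (ht : t ∈ I) : HasDerivAt (fun s => f i.succ s / f 0 s)
        (f i.succ t / f 0 t * (u i.succ (p, t) - u 0 (p, t))) t := by
      have h0 := hf 0 t ht
      exact ((hf' i.succ t ht).fun_div (hf' 0 t ht) h0).congr_deriv (by field_simp)
    have hbound := H p I hI (fun t ht => (hIS t ht).1)
      (fun i t => f i.succ t / f 0 t * (u i.succ (p, t) - u 0 (p, t))) (fun i => A i.succ)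
      (fun i t ht => mul_ne_zero (div_ne_zero (hf _ t ht) (hf _ t ht)) ((hIS t ht).2.2 i))
      (fun i t ht => by
        have hne : u i.succ (p, t) - u 0 (p, t) ≠ 0 := (hIS t ht).2.2 i
        exact ((hq i t ht).fun_mul ((hIS t ht).2.1 i)).congr_deriv (by field_simp)) hA'
    refine (encard_zeros_le_encard_zeros_deriv_add_one hI fun t ht =>
      (HasDerivAt.fun_sum fun i _ => (hq i t ht).const_mul (A i.succ)).const_add (A 0)).trans ?_
    push_cast
    gcongr

theorem inv_omega_le {r α : ℝ} (hr : r ∈ Ioo (0 : ℝ) 1) :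
    0 < omega r α ∧ (omega r α)⁻¹ ≤ |α| + (-Real.log r)⁻¹ := by
  have hL : 0 < -Real.log r := neg_pos.2 (Real.log_neg hr.1 hr.2)
  set L := -Real.log r with hLdef
  have hpow : r ^ (-α) = Real.exp (α * L) := by
    rw [Real.rpow_def_of_pos hr.1, hLdef]; ring_nf
  have key : L ≤ omega r α * (1 + |α| * L) := by
    unfold omega
    split_ifs with h
    · simp [h, hLdef]
    rw [hpow]
    rcases lt_or_gt_of_ne h with h | h
    · rw [abs_of_neg h]
      have h1 : -α * L + 1 ≤ Real.exp (-α * L) := Real.add_one_le_exp _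
      have h2 : Real.exp (α * L) * Real.exp (-α * L) = 1 := by
        rw [← Real.exp_add]; simp
      rw [div_mul_eq_mul_div, le_div_iff_of_neg h]
      nlinarith [Real.exp_pos (α * L)]
    · rw [abs_of_pos h]
      have h1 : α * L + 1 ≤ Real.exp (α * L) := Real.add_one_le_exp _
      rw [div_mul_eq_mul_div, le_div_iff₀ h]
      have : 0 < α * L := mul_pos h hL
      nlinarith
  have hpos : 0 < 1 + |α| * L := by positivity
  have hω : 0 < omega r α := pos_of_mul_pos_left (hL.trans_le key) hpos.le
  refine ⟨hω, ?_⟩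
  rw [inv_le_iff_one_le_mul₀ hω]
  have : |α| + L⁻¹ = (1 + |α| * L) / L := by field_simp; ring
  rw [this, div_mul_eq_mul_div, one_le_div hL]
  linarith

theorem omega_pos {r α : ℝ} (hr : r ∈ Ioo (0 : ℝ) 1) : 0 < omega r α := (inv_omega_le hr).1

theorem hasDerivAt_omega_exp (α t : ℝ) :
    HasDerivAt (fun s => omega (Real.exp s) α) (-(1 + α * omega (Real.exp t) α)) t := by
  unfold omega
  by_cases h : α = 0
  · simpa [h] using hasDerivAt_neg t
  · have hpow (s : ℝ) : Real.exp s ^ (-α) = Real.exp (s * -α) := (Real.exp_mul s (-α)).symm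
    simp only [if_neg h, hpow]
    exact ((((hasDerivAt_id t).mul_const (-α)).exp.sub_const 1).div_const α).congr_deriv
      (by simp only [id]; field_simp; ring)

theorem LX_eq_fderiv {h : ℝ × ℝ → ℝ} {p : ℝ × ℝ} (hd : DifferentiableAt ℝ h p) :
    LX h p = fderiv ℝ h p (p.1, -p.2) := by
  have h1 : HasDerivAt (fun r => h (r, p.2)) (fderiv ℝ h p (1, 0)) p.1 :=
    HasFDerivAt.comp_hasDerivAt (f := fun r => (r, p.2)) p.1 hd.hasFDerivAt
      ((hasDerivAt_id _).prodMk (hasDerivAt_const _ _))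
  have h2 : HasDerivAt (fun r => h (p.1, r)) (fderiv ℝ h p (0, 1)) p.2 :=
    HasFDerivAt.comp_hasDerivAt (f := fun r => (p.1, r)) p.2 hd.hasFDerivAt
      ((hasDerivAt_const _ _).prodMk (hasDerivAt_id _))
  rw [LX, h1.deriv, h2.deriv, ← smul_eq_mul, ← smul_eq_mul, ← map_smul, ← map_smul, ← map_sub]
  simp

/-- The vector field `X` generates the flow `s ↦ (exp s, ν exp (-s))`. -/
theorem hasDerivAt_comp_flow {h : ℝ × ℝ → ℝ} {ν t : ℝ}
    (hd : DifferentiableAt ℝ h (Real.exp t, ν * Real.exp (-t))) :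
    HasDerivAt (fun s => h (Real.exp s, ν * Real.exp (-s)))
      (LX h (Real.exp t, ν * Real.exp (-t))) t := by
  rw [LX_eq_fderiv hd]
  refine HasFDerivAt.comp_hasDerivAt (f := fun s => (Real.exp s, ν * Real.exp (-s))) t
    hd.hasFDerivAt ?_
  exact (Real.hasDerivAt_exp t).prodMk
    (((hasDerivAt_neg t).exp.const_mul ν).congr_deriv (by ring))

theorem contDiffOn_LX {h : ℝ × ℝ → ℝ} {U : Set (ℝ × ℝ)} {n : ℕ} (hU : IsOpen U)
    (hh : ContDiffOn ℝ (n + 1 : ℕ) h U) : ContDiffOn ℝ n (LX h) U := by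
  have hfd : ContDiffOn ℝ n (fderiv ℝ h) U := hh.fderiv_of_isOpen hU (by norm_cast)
  refine (hfd.clm_apply (contDiffOn_fst.prodMk contDiffOn_snd.neg)).congr fun p hp => ?_
  exact LX_eq_fderiv ((hh.contDiffAt (hU.mem_nhds hp)).differentiableAt (by simp))

theorem contDiffOn_iterate_LX {h : ℝ × ℝ → ℝ} {U : Set (ℝ × ℝ)} {m n : ℕ} (hU : IsOpen U)
    (hh : ContDiffOn ℝ (n + m : ℕ) h U) : ContDiffOn ℝ n (LX^[m] h) U := by
  induction m generalizing h with
  | zero => exact hh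
  | succ m ih => exact ih (contDiffOn_LX hU hh)

section Corner

variable {E : Type*}

/-- The point `(exp t, ν exp (-t))` of the hyperbola `r ρ = ν`, together with a parameter `e`, as a
function of `((e, ν), t)`. -/
noncomputable def flow (x : (E × ℝ) × ℝ) : (ℝ × ℝ) × E :=
  ((Real.exp x.2, x.1.2 * Real.exp (-x.2)), x.1.1)

variable [TopologicalSpace E] (e₀ : E)

/-- The filter of points of the hyperbolas approaching the corner of the open unit square, as the
parameter tends to `e₀`. -/
noncomputable def cornerFilter : Filter ((E × ℝ) × ℝ) :=
  comap flow (𝓝[Ioo (0 : ℝ) 1 ×ˢ Ioo (0 : ℝ) 1] ((0 : ℝ), (0 : ℝ)) ×ˢ 𝓝 e₀)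

theorem tendsto_flow : Tendsto flow (cornerFilter e₀)
    (𝓝[Ioo (0 : ℝ) 1 ×ˢ Ioo (0 : ℝ) 1] ((0 : ℝ), (0 : ℝ)) ×ˢ 𝓝 e₀) :=
  tendsto_comap

theorem eventually_flow_mem :
    ∀ᶠ x in cornerFilter e₀, (flow x).1 ∈ Ioo (0 : ℝ) 1 ×ˢ Ioo (0 : ℝ) 1 :=
  (tendsto_fst.comp (tendsto_flow e₀)).eventually self_mem_nhdsWithin

variable {e₀}

theorem tendsto_comp_param {c : E → ℝ} (hc : ContinuousAt c e₀) :
    Tendsto (fun x => c x.1.1) (cornerFilter e₀) (𝓝 (c e₀)) :=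
  Tendsto.comp (f := fun x : (E × ℝ) × ℝ => x.1.1) hc (tendsto_snd.comp (tendsto_flow e₀))

theorem tendsto_exp_corner :
    Tendsto (fun x : (E × ℝ) × ℝ => Real.exp x.2) (cornerFilter e₀) (𝓝[>] 0) := by
  refine tendsto_nhdsWithin_iff.2 ⟨?_, Eventually.of_forall fun x => Real.exp_pos _⟩
  have h : Tendsto (fun x : (E × ℝ) × ℝ => (flow x).1) (cornerFilter e₀)
      (𝓝 ((0 : ℝ), (0 : ℝ))) :=
    (tendsto_fst.comp (tendsto_flow e₀)).mono_right nhdsWithin_le_nhds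
  exact (continuous_fst.tendsto _).comp h

theorem tendstoWithDerivs_inv_omega {γ : E → ℝ} (hγ : ContinuousAt γ e₀) (hγ0 : γ e₀ = 0)
    (n : ℕ) : TendstoWithDerivs (cornerFilter e₀) n
      (fun x => (omega (Real.exp x.2) (γ x.1.1))⁻¹) 0 := by
  have hγt : Tendsto (fun x => γ x.1.1) (cornerFilter e₀) (𝓝 0) :=
    hγ0 ▸ tendsto_comp_param hγ
  refine TendstoWithDerivs.of_bernoulli (c := fun p => γ p.1) hγt ?_ ?_
  · have hlog : Tendsto (fun x : (E × ℝ) × ℝ => (-Real.log (Real.exp x.2))⁻¹)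
        (cornerFilter e₀) (𝓝 0) :=
      tendsto_inv_atTop_zero.comp (tendsto_neg_atBot_atTop.comp
        (Real.tendsto_log_nhdsGT_zero.comp tendsto_exp_corner))
    refine squeeze_zero' ?_ ?_ (by simpa only [abs_zero, add_zero] using hγt.abs.add hlog)
    · filter_upwards [eventually_flow_mem e₀] with x hx using (inv_pos.2 (omega_pos hx.1)).le
    · filter_upwards [eventually_flow_mem e₀] with x hx using (inv_omega_le hx.1).2
  · filter_upwards [eventually_flow_mem e₀] with x hx
    have hω : omega (Real.exp x.2) (γ x.1.1) ≠ 0 := (omega_pos hx.1).ne'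
    exact ((hasDerivAt_omega_exp _ _).fun_inv hω).congr_deriv (by field_simp)

theorem tendstoWithDerivs_iterate_LX {g : ℝ × ℝ → E → ℝ} {m n : ℕ}
    (hg : ∀ e, ContDiffOn ℝ (n + m : ℕ) (fun p => g p e) (Ioo (0 : ℝ) 1 ×ˢ Ioo (0 : ℝ) 1))
    (hlim : ∀ k ≤ n + m, Tendsto (fun q : (ℝ × ℝ) × E => LX^[k] (fun p => g p q.2) q.1)
      (𝓝[Ioo (0 : ℝ) 1 ×ˢ Ioo (0 : ℝ) 1] ((0 : ℝ), (0 : ℝ)) ×ˢ 𝓝 e₀) (𝓝 0)) :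
    TendstoWithDerivs (cornerFilter e₀) n
      (fun x => LX^[m] (fun p => g p x.1.1) (flow x).1) 0 := by
  induction n generalizing m with
  | zero => exact (hlim m (by simp)).comp (tendsto_flow e₀)
  | succ n ih =>
    have hnm : n + 1 + m = n + (m + 1) := by ring
    refine ⟨(hlim m (by simp)).comp (tendsto_flow e₀), _, ?_,
      ih (m := m + 1) (hnm ▸ hg) (hnm ▸ hlim)⟩
    filter_upwards [eventually_flow_mem e₀] with x hx
    have hU : IsOpen (Ioo (0 : ℝ) 1 ×ˢ Ioo (0 : ℝ) 1) := isOpen_Ioo.prod isOpen_Ioo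
    have hd := ((contDiffOn_iterate_LX hU (hg x.1.1)).contDiffAt
      (hU.mem_nhds hx)).differentiableAt (by simp)
    simp only [Function.iterate_succ_apply']
    exact hasDerivAt_comp_flow hd

end Corner

/-- The monomial `r ^ a * ρ ^ b * ∏ j, omega r (γ j) ^ c j`, times `1 + G`, along the hyperbola
`r ρ = ν` parametrized by `r = exp t`. -/
noncomputable def hyperbolaTerm {ι : Type*} [Fintype ι] (a b ν : ℝ) (c γ : ι → ℝ) (G : ℝ → ℝ)
    (t : ℝ) : ℝ :=
  Real.exp (a * t + b * (Real.log ν - t) + ∑ j, c j * Real.log (omega (Real.exp t) (γ j))) *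
    (1 + G t)

section HyperbolaTerm

variable {ι : Type*} [Fintype ι] {a b ν t : ℝ} {c γ : ι → ℝ} {G : ℝ → ℝ}

theorem hyperbolaTerm_eq (hν : 0 < ν) (ht : Real.exp t < 1) :
    Real.exp t ^ a * (ν * Real.exp (-t)) ^ b * (∏ j, omega (Real.exp t) (γ j) ^ c j) *
      (1 + G t) = hyperbolaTerm a b ν c γ G t := by
  have hω (j : ι) : omega (Real.exp t) (γ j) ^ c j =
      Real.exp (c j * Real.log (omega (Real.exp t) (γ j))) := by
    rw [Real.rpow_def_of_pos (omega_pos ⟨Real.exp_pos t, ht⟩), mul_comm]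
  have hρ : (ν * Real.exp (-t)) ^ b = Real.exp (b * (Real.log ν - t)) := by
    rw [Real.rpow_def_of_pos (by positivity), Real.log_mul hν.ne' (Real.exp_ne_zero _),
      Real.log_exp, mul_comm, sub_eq_add_neg]
  simp only [hyperbolaTerm, hω, hρ, ← Real.exp_sum, Real.exp_add, ← Real.exp_mul, mul_comm t a]

theorem hyperbolaTerm_ne_zero (hG : 1 + G t ≠ 0) : hyperbolaTerm a b ν c γ G t ≠ 0 :=
  mul_ne_zero (Real.exp_ne_zero _) hG

theorem hasDerivAt_hyperbolaTerm {G' : ℝ} (ht : Real.exp t < 1) (hG : 1 + G t ≠ 0)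
    (hG' : HasDerivAt G G' t) :
    HasDerivAt (hyperbolaTerm a b ν c γ G) (hyperbolaTerm a b ν c γ G t *
      (a - b + ∑ j, c j * -(γ j + (omega (Real.exp t) (γ j))⁻¹) + G' * (1 + G t)⁻¹)) t := by
  have hω (j : ι) : HasDerivAt (fun s => c j * Real.log (omega (Real.exp s) (γ j)))
      (c j * -(γ j + (omega (Real.exp t) (γ j))⁻¹)) t := by
    have h0 := (omega_pos (α := γ j) ⟨Real.exp_pos t, ht⟩).ne'
    exact (((hasDerivAt_omega_exp (γ j) t).log h0).const_mul (c j)).congr_deriv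
      (by field_simp; ring)
  have hlin : HasDerivAt (fun s => a * s + b * (Real.log ν - s)) (a - b) t :=
    (((hasDerivAt_id t).const_mul a).add
      (((hasDerivAt_id t).const_sub (Real.log ν)).const_mul b)).congr_deriv (by ring)
  refine ((hlin.fun_add (HasDerivAt.fun_sum fun j _ => hω j)).exp.fun_mul
    (hG'.const_add 1)).congr_deriv ?_
  rw [hyperbolaTerm]
  field_simp

end HyperbolaTerm

/-- Derivation–division theorem (Theorem 5.4 of the paper). -/
theorem derivation_division (d l : ℕ) (hd : 1 ≤ d) (hl : 1 ≤ l)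
    (lam₀ : Fin d → ℝ) (nJ : ℕ)
    (a b : Fin l → (Fin d → ℝ) → ℝ)
    (c : Fin l → Fin nJ → (Fin d → ℝ) → ℝ)
    (γ : Fin nJ → (Fin d → ℝ) → ℝ)
    (A : Fin l → (Fin d → ℝ) → ℝ)
    (g : Fin l → ℝ × ℝ → (Fin d → ℝ) → ℝ)
    (ha : ∀ i, ContDiff ℝ (⊤ : ℕ∞) (a i)) (hb : ∀ i, ContDiff ℝ (⊤ : ℕ∞) (b i))
    (hc : ∀ i j, ContDiff ℝ (⊤ : ℕ∞) (c i j))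
    (hγ : ∀ j, ContDiff ℝ (⊤ : ℕ∞) (γ j)) (hγ0 : ∀ j, γ j lam₀ = 0)
    (hA : ∀ i, Continuous (A i))
    (hg : ∀ i lam, ContDiffOn ℝ l (fun p => g i p lam)
      (Set.Ioo (0:ℝ) 1 ×ˢ Set.Ioo (0:ℝ) 1))
    (hgLX : ∀ i, ∀ m ≤ l,
      Filter.Tendsto
        (fun q : (ℝ × ℝ) × (Fin d → ℝ) => (LX^[m] (fun p => g i p q.2)) q.1)
        ((nhdsWithin ((0:ℝ), (0:ℝ)) (Set.Ioo (0:ℝ) 1 ×ˢ Set.Ioo (0:ℝ) 1)) ×ˢ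
          (nhds lam₀))
        (nhds 0))
    (M : Fin l → ℝ × ℝ → (Fin d → ℝ) → ℝ)
    (hM : ∀ i p lam, M i p lam =
      p.1 ^ (a i lam) * p.2 ^ (b i lam) * ∏ j, (omega p.1 (γ j lam)) ^ (c i j lam))
    (V : ℝ × ℝ → (Fin d → ℝ) → ℝ)
    (hV : ∀ p lam, V p lam = ∑ i, A i lam * M i p lam * (1 + g i p lam))
    (hres : Function.Injective (fun i => a i lam₀ - b i lam₀)) :
    ∃ ε ∈ Set.Ioo (0:ℝ) 1, ∃ B ∈ nhds lam₀, ∀ lam ∈ B,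
      (∀ i, A i lam = 0) ∨
      (∀ ν : ℝ, 0 < ν →
        Set.encard {p : ℝ × ℝ | p.1 * p.2 = ν ∧ p.1 ∈ Set.Ioc 0 ε ∧
          p.2 ∈ Set.Ioc 0 ε ∧ V p lam = 0} ≤ (l - 1 : ℕ)) := by
  obtain ⟨k, rfl⟩ := Nat.exists_eq_add_of_le' hl
  let F := cornerFilter lam₀
  let G (i : Fin (k + 1)) (m : ℕ) (x : ((Fin d → ℝ) × ℝ) × ℝ) : ℝ :=
    LX^[m] (fun p => g i p x.1.1) (flow x).1
  let u (i : Fin (k + 1)) (x : ((Fin d → ℝ) × ℝ) × ℝ) : ℝ :=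
    a i x.1.1 - b i x.1.1 +
      ∑ j, c i j x.1.1 * -(γ j x.1.1 + (omega (Real.exp x.2) (γ j x.1.1))⁻¹) +
      G i 1 x * (1 + G i 0 x)⁻¹
  have hparam {h : (Fin d → ℝ) → ℝ} (hh : ContDiff ℝ (⊤ : ℕ∞) h) :
      TendstoWithDerivs F k (fun x => h x.1.1) (h lam₀) :=
    .comp_fst (c := fun p : (Fin d → ℝ) × ℝ => h p.1) (tendsto_comp_param hh.continuous.continuousAt)
  have hG0 (i : Fin (k + 1)) : TendstoWithDerivs F (k + 1) (G i 0) 0 :=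
    tendstoWithDerivs_iterate_LX (hg i) (hgLX i)
  have hu (i : Fin (k + 1)) : TendstoWithDerivs F k (u i) (a i lam₀ - b i lam₀) := by
    have hω (j : Fin nJ) := (hparam (hc i j)).mul ((hparam (hγ j)).add
      (tendstoWithDerivs_inv_omega (hγ j).continuous.continuousAt (hγ0 j) k)).neg
    have hG1 : TendstoWithDerivs F k (G i 1) 0 := tendstoWithDerivs_iterate_LX (hg i) (hgLX i)
    have hone : TendstoWithDerivs F k (fun x => 1 + G i 0 x) 1 := by
      simpa using (hparam (h := fun _ => 1) contDiff_const).add (hG0 i).of_succ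
    simpa only [hγ0, add_zero, neg_zero, mul_zero, Finset.sum_const_zero, zero_mul] using
      (((hparam (ha i)).sub (hparam (hb i))).add
      (TendstoWithDerivs.sum Finset.univ fun j _ => hω j)).add (hG1.mul (hone.inv one_ne_zero))
  obtain ⟨S, hS, H⟩ := exists_encard_zeros_sum_le hres hu
  have hS' : ∀ᶠ x in F, x ∈ S ∧ ∀ i, 1 + G i 0 x ≠ 0 ∧
      HasDerivAt (fun s => G i 0 (x.1, s)) (G i 1 x) x.2 := by
    refine Filter.Eventually.and hS (Filter.eventually_all.2 fun i => ?_)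
    have hne : ∀ᶠ x in F, 1 + G i 0 x ≠ 0 :=
      ((hG0 i).tendsto.const_add 1).eventually_ne (by norm_num)
    filter_upwards [hne, eventually_flow_mem lam₀] with x hx hxU
    have hU : IsOpen (Ioo (0 : ℝ) 1 ×ˢ Ioo (0 : ℝ) 1) := isOpen_Ioo.prod isOpen_Ioo
    exact ⟨hx, hasDerivAt_comp_flow
      (((hg i x.1.1).contDiffAt (hU.mem_nhds hxU)).differentiableAt (by simp))⟩
  obtain ⟨T, hT, hTS⟩ := Filter.mem_comap.1 hS'
  obtain ⟨Q, hQ, B, hB, hQB⟩ := Filter.mem_prod_iff.1 hT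
  obtain ⟨δ, hδ, hδQ⟩ := Metric.mem_nhdsWithin_iff.1 hQ
  obtain ⟨ε, hε0, hε⟩ := exists_between (lt_min hδ one_pos)
  obtain ⟨hεδ, hε1⟩ := lt_min_iff.1 hε
  refine ⟨ε, ⟨hε0, hε1⟩, B, hB, fun lam hlam => or_iff_not_imp_left.2 fun hA0 ν hν => ?_⟩
  push Not at hA0
  let I : Set ℝ := {t | Real.exp t ≤ ε ∧ ν * Real.exp (-t) ≤ ε}
  have hI : I.OrdConnected := by
    refine ⟨fun x hx y hy t ht => ⟨(Real.exp_le_exp.2 ht.2).trans hy.1, le_trans ?_ hx.2⟩⟩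
    gcongr
    exact ht.1
  have hIS (t : ℝ) (ht : t ∈ I) : ((lam, ν), t) ∈ S ∧ ∀ i, 1 + G i 0 ((lam, ν), t) ≠ 0 ∧
      HasDerivAt (fun s => G i 0 ((lam, ν), s)) (G i 1 ((lam, ν), t)) t := by
    refine hTS (hQB ⟨hδQ ⟨?_, ?_⟩, hlam⟩ : flow ((lam, ν), t) ∈ T)
    · rw [← Prod.zero_eq_mk, mem_ball_zero_iff, Prod.norm_def, max_lt_iff]
      exact ⟨(abs_of_pos (Real.exp_pos t)).trans_lt (ht.1.trans_lt hεδ),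
        (abs_of_pos (mul_pos hν (Real.exp_pos (-t)))).trans_lt (ht.2.trans_lt hεδ)⟩
    · exact ⟨⟨Real.exp_pos _, ht.1.trans_lt hε1⟩,
        ⟨mul_pos hν (Real.exp_pos _), ht.2.trans_lt hε1⟩⟩
  let f (i : Fin (k + 1)) : ℝ → ℝ := hyperbolaTerm (a i lam) (b i lam) ν (fun j => c i j lam)
    (fun j => γ j lam) (fun s => G i 0 ((lam, ν), s))
  have hbound : {t | t ∈ I ∧ ∑ i, A i lam * f i t = 0}.encard ≤ k :=
    H (lam, ν) I hI (fun t ht => (hIS t ht).1) f (fun i => A i lam)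
      (fun i t ht => hyperbolaTerm_ne_zero ((hIS t ht).2 i).1)
      (fun i t ht => hasDerivAt_hyperbolaTerm (ht.1.trans_lt hε1) ((hIS t ht).2 i).1
        ((hIS t ht).2 i).2) hA0
  refine le_trans (Set.encard_le_encard ?_) ((Set.encard_image_le
    (fun t => (Real.exp t, ν * Real.exp (-t))) _).trans hbound)
  rintro ⟨r, ρ⟩ ⟨hp, hr, hρ, hV0⟩
  simp only at hp hr hρ
  have hexp : Real.exp (Real.log r) = r := Real.exp_log hr.1
  have hρ' : ν * Real.exp (-Real.log r) = ρ := by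
    rw [Real.exp_neg, hexp, ← hp, mul_comm r, mul_inv_cancel_right₀ hr.1.ne']
  refine ⟨Real.log r, ⟨⟨hexp.trans_le hr.2, hρ'.trans_le hρ.2⟩, ?_⟩, Prod.ext hexp hρ'⟩
  rw [← hV0, hV]
  refine Finset.sum_congr rfl fun i _ => ?_
  rw [hM, mul_assoc]
  congr 1
  refine (hyperbolaTerm_eq hν (hexp.trans_lt (hr.2.trans_lt hε1))).symm.trans ?_
  simp only [G, flow, hexp, hρ', Function.iterate_zero, id]
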